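/- Let d : ℕ → ℕ be the sequence counting the basic support τ-tilting modules over the square-radical-zero D_n-type algebras, i.e. d 4 = 32, d 5 = 78, and d (n+2) = 2 · d (n+1) + d n for all n ≥ 4. Then for every n ≥ 4, (d n : ℝ) = ((3√2 − 1)·(1+√2)^(n−1) + (3√2 + 1)·(1−√2)^(n−1)) / √2. -/

import Mathlib

/-- The number of basic support τ-tilting modules over the square-radical-zero
`D_n`-type algebras satisfies `d 4 = 32`, `d 5 = 78` and the Pell-type
recurrence; its closed formula. -/
theorem stau_tilt_Dn_closed_formula (d : ℕ → ℕ) (h4 : d 4 = 32) (h5 : d 5 = 78)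
    (hrec : ∀ n ≥ 4, d (n + 2) = 2 * d (n + 1) + d n) :
    ∀ n ≥ 4, (d n : ℝ) =
      ((3 * Real.sqrt 2 - 1) * (1 + Real.sqrt 2) ^ (n - 1) +
        (3 * Real.sqrt 2 + 1) * (1 - Real.sqrt 2) ^ (n - 1)) /
        Real.sqrt 2 := by
  have hs : Real.sqrt 2 ^ 2 = 2 := Real.sq_sqrt (by norm_num)
  have hs0 : Real.sqrt 2 ≠ 0 := by positivity
  have key : ∀ k : ℕ, (d (k + 4) : ℝ) * Real.sqrt 2 =
      (3 * Real.sqrt 2 - 1) * (1 + Real.sqrt 2) ^ (k + 3) +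
        (3 * Real.sqrt 2 + 1) * (1 - Real.sqrt 2) ^ (k + 3) := by
    generalize Real.sqrt 2 = s at hs
    intro k
    induction k using Nat.twoStepInduction with
    | zero => simp only [zero_add, h4]; grind
    | one => simp only [Nat.reduceAdd, h5]; grind
    | more k ih₀ ih₁ =>
      have hd : (d (k + 2 + 4) : ℝ) = 2 * d (k + 1 + 4) + d (k + 4) := by
        exact_mod_cast hrec (k + 4) (by lia)
      have hp : (1 + s) ^ (k + 2 + 3) = 2 * (1 + s) ^ (k + 1 + 3) + (1 + s) ^ (k + 3) := by
        linear_combination (1 + s) ^ (k + 3) * hs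
      have hm : (1 - s) ^ (k + 2 + 3) = 2 * (1 - s) ^ (k + 1 + 3) + (1 - s) ^ (k + 3) := by
        linear_combination (1 - s) ^ (k + 3) * hs
      rw [hd, hp, hm]
      linear_combination 2 * ih₁ + ih₀
  intro n hn
  obtain ⟨k, rfl⟩ := Nat.exists_eq_add_of_le' hn
  rw [eq_div_iff hs0]
  exact key k
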